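/- arXiv:1802.10152 — 2 statements merged into one kernel-verified Lean document; each statement's English description precedes it below -/
import Mathlib

section
/- Let N ≥ 1, let W be a real N×N matrix, let ℓ ∈ ℝ^N satisfy ℓᵀ𝟏 ≠ 0, and set J_ℓ = (𝟏ℓᵀ)/(ℓᵀ𝟏). If ℓᵀW = ℓᵀ and W𝟏 = 𝟏, then the characteristic polynomials satisfy the identity X · charpoly(W) = (X − 1) · charpoly(W − J_ℓ) in ℝ[X]. In particular, the multiset of eigenvalues of W − J_ℓ is obtained from that of W by replacing one occurrence of the eigenvalue 1 by the eigenvalue 0. -/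
open Matrix Polynomial

theorem det_one_add_smul_vecMulVec {n R : Type*} [Fintype n] [DecidableEq n] [CommRing R]
    (c : R) (u v : n → R) : (1 + c • vecMulVec u v).det = 1 + c * (v ⬝ᵥ u) := by
  rw [← smul_vecMulVec, vecMulVec_eq Unit, det_one_add_replicateCol_mul_replicateRow,
    dotProduct_smul, smul_eq_mul]

/-- Deflating the eigenvalue `1` of `W`, with right eigenvector `u`, by a rank-one matrix
`u vᵀ` such that `vᵀ u = 1`. -/
theorem X_mul_charpoly_eq_of_mulVec_eq_self {n R : Type*} [Fintype n] [DecidableEq n] [CommRing R]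
    (W : Matrix n n R) (u v : n → R) (hu : W *ᵥ u = u) (huv : v ⬝ᵥ u = 1) :
    X * W.charpoly = (X - 1) * (W - vecMulVec u v).charpoly := by
  set J := vecMulVec u v with hJ
  have hWJ : W * J = J := by rw [hJ, mul_vecMulVec, hu]
  have hJJ : J * J = J := by rw [hJ, vecMulVec_mul_vecMulVec, huv, one_smul]
  have hJC : J.map (C : R →+* R[X]) = vecMulVec (C ∘ u) (C ∘ v) := by
    ext i j : 2
    simp [hJ, vecMulVec_apply]
  have hdet (c : R[X]) : (1 + c • J.map (C : R →+* R[X])).det = 1 + c := by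
    rw [hJC, det_one_add_smul_vecMulVec, ← RingHom.map_dotProduct, huv, map_one, mul_one]
  have hWJC : W.map (C : R →+* R[X]) * J.map (C : R →+* R[X]) = J.map (C : R →+* R[X]) := by
    rw [← Matrix.map_mul, hWJ]
  have hJJC : J.map (C : R →+* R[X]) * J.map (C : R →+* R[X]) = J.map (C : R →+* R[X]) := by
    rw [← Matrix.map_mul, hJJ]
  have hchar (M : Matrix n n R) :
      M.charmatrix = (X : R[X]) • (1 : Matrix n n R[X]) - M.map (C : R →+* R[X]) := by
    rw [charmatrix, smul_one_eq_diagonal]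
    rfl
  have hmul : W.charmatrix * (1 + (X - 1 : R[X]) • J.map (C : R →+* R[X])) =
      (W - J).charmatrix * (1 + (X - 2 : R[X]) • J.map (C : R →+* R[X])) := by
    rw [hchar, hchar, Matrix.map_sub (C : R →+* R[X]) (map_sub _)]
    simp only [mul_add, sub_mul, mul_one, Matrix.mul_smul, Matrix.smul_mul, one_mul, hWJC, hJJC]
    module
  have h := congrArg det hmul
  rw [det_mul, det_mul, hdet, hdet] at h
  rw [charpoly, charpoly]
  linear_combination h

theorem charpoly_consensus_shift {N : ℕ} (hN : 1 ≤ N)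
    (W : Matrix (Fin N) (Fin N) ℝ) (ℓ : Fin N → ℝ)
    (hℓ : ℓ ⬝ᵥ (1 : Fin N → ℝ) ≠ 0)
    (J : Matrix (Fin N) (Fin N) ℝ)
    (hJ : J = (ℓ ⬝ᵥ (1 : Fin N → ℝ))⁻¹ • Matrix.vecMulVec (1 : Fin N → ℝ) ℓ)
    (hleft : W.vecMul ℓ = ℓ) (hright : W.mulVec (1 : Fin N → ℝ) = 1) :
    Polynomial.X * W.charpoly = (Polynomial.X - 1) * (W - J).charpoly ∧
    (1 : ℂ) ::ₘ ((W - J).map Complex.ofReal).charpoly.roots =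
      (0 : ℂ) ::ₘ (W.map Complex.ofReal).charpoly.roots := by
  have hreal : X * W.charpoly = (X - 1) * (W - J).charpoly := by
    rw [hJ, ← vecMulVec_smul]
    refine X_mul_charpoly_eq_of_mulVec_eq_self W 1 _ hright ?_
    rw [smul_dotProduct, smul_eq_mul, inv_mul_cancel₀ hℓ]
  refine ⟨hreal, ?_⟩
  have hcomplex : X * (W.map Complex.ofReal).charpoly =
      (X - C 1) * ((W - J).map Complex.ofReal).charpoly := by
    have h := congrArg (Polynomial.map Complex.ofRealHom) hreal
    simp only [Polynomial.map_mul, Polynomial.map_sub, Polynomial.map_X, Polynomial.map_one,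
      ← charpoly_map] at h
    rw [C_1]
    exact h
  have hroots := congrArg roots hcomplex
  rw [roots_mul (mul_ne_zero X_ne_zero (charpoly_monic _).ne_zero),
    roots_mul (mul_ne_zero (X_sub_C_ne_zero 1) (charpoly_monic _).ne_zero),
    roots_X, roots_X_sub_C, Multiset.singleton_add, Multiset.singleton_add] at hroots
  exact hroots.symm
end

section
/- Let N ≥ 1, let W be a real N×N matrix, let ℓ ∈ ℝ^N satisfy ℓᵀ𝟏 ≠ 0, and set J_ℓ = (𝟏ℓᵀ)/(ℓᵀ𝟏). Suppose ℓᵀW = ℓᵀ and W𝟏 = 𝟏, and let p be a real polynomial with p(1) = 1. Then X · charpoly(p(W)) = (X − 1) · charpoly(p(W) − J_ℓ) in ℝ[X]. -/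
open Matrix Polynomial

theorem aeval_mulVec_of_mulVec_eq_self {R n : Type*} [CommRing R] [Fintype n] [DecidableEq n]
    {W : Matrix n n R} {v : n → R} (h : W *ᵥ v = v) (p : R[X]) :
    aeval W p *ᵥ v = p.eval 1 • v := by
  induction p using Polynomial.induction_on with
  | C a => simp [Algebra.algebraMap_eq_smul_one, smul_mulVec]
  | add p q hp hq => simp [add_mulVec, hp, hq, add_smul]
  | monomial k a ih =>
    rw [pow_succ, ← mul_assoc, map_mul, aeval_X, ← mulVec_mulVec, h, ih]
    simp

theorem charpoly_one_sub_vecMulVec {R n : Type*} [CommRing R] [Nontrivial R] [Fintype n]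
    [DecidableEq n] [Nonempty n] {u v : n → R} (h : u ⬝ᵥ v = 1) :
    (1 - vecMulVec u v).charpoly = X * (X - 1) ^ (Fintype.card n - 1) := by
  have key : (1 - vecMulVec u v) = vecMulVec (-u) v - scalar n (-1 : R) := by
    rw [map_neg, map_one, neg_vecMulVec]; abel
  obtain ⟨k, hk⟩ := Nat.exists_eq_succ_of_ne_zero (Fintype.card_ne_zero (α := n))
  rw [key, charpoly_sub_scalar, charpoly_vecMulVec, neg_dotProduct, h, hk]
  simp
  ring

/-- Removing a rank-one projection onto a `1`-eigenvector replaces one eigenvalue `1` by `0`. -/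
theorem X_mul_charpoly_of_mulVec_eq_self {R n : Type*} [CommRing R] [IsDomain R] [Fintype n]
    [DecidableEq n] [Nonempty n] {A : Matrix n n R} {u v : n → R} (hA : A *ᵥ u = u)
    (h : u ⬝ᵥ v = 1) :
    X * A.charpoly = (X - 1) * (A - vecMulVec u v).charpoly := by
  have hAJ : A * vecMulVec u v = vecMulVec u v := by rw [mul_vecMulVec, hA]
  have hfac : charmatrix A * charmatrix (1 - vecMulVec u v) =
      (X - 1 : R[X]) • charmatrix (A - vecMulVec u v) := by
    have hAJ' := congrArg (C : R →+* R[X]).mapMatrix hAJ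
    rw [map_mul] at hAJ'
    have hX (M : Matrix n n R[X]) : scalar n (X : R[X]) * M = (X : R[X]) • M := by
      rw [scalar_apply, ← smul_eq_diagonal_mul]
    have hX' (M : Matrix n n R[X]) : M * scalar n (X : R[X]) = (X : R[X]) • M := by
      rw [← (scalar_commute X (fun r => Commute.all X r) M).eq, hX]
    simp only [charmatrix, map_sub, map_one, mul_sub, sub_mul, hAJ', hX, hX', sub_smul,
      smul_sub, mul_one, one_smul]
    abel
  have hdet := congrArg det hfac
  rw [det_mul, det_smul] at hdet
  change A.charpoly * (1 - vecMulVec u v).charpoly = _ * (A - vecMulVec u v).charpoly at hdet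
  rw [charpoly_one_sub_vecMulVec h] at hdet
  have hne : (X - 1 : R[X]) ^ (Fintype.card n - 1) ≠ 0 :=
    pow_ne_zero _ (by simpa using X_sub_C_ne_zero (1 : R))
  apply mul_left_cancel₀ hne
  rw [← mul_assoc (_ ^ _) (X - 1), pow_sub_one_mul Fintype.card_ne_zero, ← hdet]
  ring

theorem charpoly_filtered_consensus_shift {N : ℕ} (hN : 1 ≤ N)
    (W : Matrix (Fin N) (Fin N) ℝ) (ℓ : Fin N → ℝ)
    (hℓ : ℓ ⬝ᵥ (1 : Fin N → ℝ) ≠ 0)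
    (J : Matrix (Fin N) (Fin N) ℝ)
    (hJ : J = (ℓ ⬝ᵥ (1 : Fin N → ℝ))⁻¹ • Matrix.vecMulVec (1 : Fin N → ℝ) ℓ)
    (hleft : W.vecMul ℓ = ℓ) (hright : W.mulVec (1 : Fin N → ℝ) = 1)
    (p : Polynomial ℝ) (hp : p.eval 1 = 1) :
    Polynomial.X * (Polynomial.aeval W p).charpoly =
      (Polynomial.X - 1) * (Polynomial.aeval W p - J).charpoly := by
  have : Nonempty (Fin N) := ⟨⟨0, hN⟩⟩
  rw [hJ, ← vecMulVec_smul]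
  apply X_mul_charpoly_of_mulVec_eq_self
  · rw [aeval_mulVec_of_mulVec_eq_self hright, hp, one_smul]
  · rw [dotProduct_smul, dotProduct_comm 1 ℓ, smul_eq_mul, inv_mul_cancel₀ hℓ]
end
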